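/- Let m and n be positive integers, let λ ∈ ℂ be a primitive m-th root of unity, and let f be a holomorphic map defined on a neighborhood of 0 in ℂⁿ with f(0) = 0 and f'(0) = λ·I. Then there exist open neighborhoods U, V of 0 in ℂⁿ and a biholomorphic map h : U → V with h(0) = 0 and h'(0) = I such that the conjugated map g = h⁻¹ ∘ f ∘ h satisfies g(x) = λx + o(‖x‖^m) as x → 0. -/

import Mathlib

open Asymptotics Filter

open Topology Metric Set

section Holomorphic

variable {E F : Type*} [NormedAddCommGroup E] [NormedSpace ℂ E]
  [NormedAddCommGroup F] [NormedSpace ℂ F]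

/-- If a holomorphic map vanishes to order higher than `k` at `0` along every complex line, then it
is `O(‖x‖ ^ (k + 1))` uniformly in all directions. -/
theorem isBigO_norm_pow_succ_of_forall_line {ψ : E → F} {k : ℕ}
    (hd : ∀ᶠ x in 𝓝 0, DifferentiableAt ℂ ψ x) (h0 : ψ 0 = 0)
    (hl : ∀ v : E, (fun t : ℂ => ψ (t • v)) =o[𝓝 0] fun t => t ^ k) :
    ψ =O[𝓝 0] fun x => ‖x‖ ^ (k + 1) := by
  have hb : ∀ᶠ x in 𝓝 0, ‖ψ x‖ < 1 := by
    have hc : ContinuousAt (fun x => ‖ψ x‖) 0 := hd.self_of_nhds.continuousAt.norm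
    exact hc.eventually_lt_const (by simp [h0])
  obtain ⟨r, hr, hball⟩ := Metric.eventually_nhds_iff_ball.1 (hd.and hb)
  refine IsBigO.of_bound ((1 / r) ^ (k + 1)) ?_
  filter_upwards [ball_mem_nhds (0 : E) hr] with z hz
  rcases eq_or_ne z 0 with rfl | hz0
  · simp [h0]
  have hzpos : 0 < ‖z‖ := norm_pos_iff.2 hz0
  have hline : MapsTo (fun t : ℂ => t • z) (ball 0 (r / ‖z‖)) (ball 0 r) := by
    intro t ht
    simpa [norm_smul, lt_div_iff₀ hzpos] using ht
  have hS := Complex.dist_le_mul_div_pow_of_mapsTo_ball_of_isLittleO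
    (f := fun t : ℂ => ψ (t • z)) (c := 0) (z := 1) (R₁ := r / ‖z‖) (R₂ := 1) (n := k)
    (fun t ht => ((hball _ (hline ht)).1.comp t (by fun_prop)).differentiableWithinAt)
    (fun t ht => by simpa [h0] using (hball _ (hline ht)).2.le)
    (by simpa [h0] using (hl z).norm_right)
    (by simpa [lt_div_iff₀ hzpos] using hz)
  simpa [h0, div_eq_inv_mul, mul_pow] using hS

/-- A holomorphic map that is `o(‖x‖ ^ k)` at `0` is `O(‖x‖ ^ (k + 1))`. -/
theorem isBigO_norm_pow_succ_of_isLittleO {ψ : E → F} {k : ℕ}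
    (hd : ∀ᶠ x in 𝓝 0, DifferentiableAt ℂ ψ x) (h0 : ψ 0 = 0)
    (h : ψ =o[𝓝 0] fun x => ‖x‖ ^ k) :
    ψ =O[𝓝 0] fun x => ‖x‖ ^ (k + 1) := by
  refine isBigO_norm_pow_succ_of_forall_line hd h0 fun v => ?_
  have ht : Tendsto (fun t : ℂ => t • v) (𝓝 0) (𝓝 0) :=
    Continuous.tendsto' (by fun_prop) _ _ (by simp)
  refine (h.comp_tendsto ht).trans_isBigO (IsBigO.of_bound (‖v‖ ^ k) (.of_forall fun t => ?_))
  simp [norm_smul, mul_pow, mul_comm]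

/-- Cauchy-type estimate: a holomorphic map that is `O(‖x‖ ^ (k + 1))` at `0` varies by at most
`O(‖x‖ ^ k)` times the distance between two points at distance `O(‖x‖)` from `0`
that are `o(‖x‖)`-close to each other. -/
theorem isBigO_comp_sub_comp {ψ : E → F} {k : ℕ} {u v : E → E}
    (hd : ∀ᶠ x in 𝓝 0, DifferentiableAt ℂ ψ x)
    (hψ : ψ =O[𝓝 0] fun x => ‖x‖ ^ (k + 1))
    (hu : u =O[𝓝 0] fun x => x) (huv : (fun x => v x - u x) =o[𝓝 0] fun x => x) :
    (fun x => ψ (v x) - ψ (u x)) =O[𝓝 0] fun x => ‖x‖ ^ k * ‖v x - u x‖ := by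
  obtain ⟨C, hC, hψC⟩ := hψ.exists_pos
  obtain ⟨r, hr, hball⟩ := Metric.eventually_nhds_iff_ball.1 (hd.and hψC.bound)
  obtain ⟨A, hA, huA⟩ := hu.exists_pos
  have hsmall : ∀ᶠ x : E in 𝓝 0, (A + 1) * ‖x‖ < r := by
    have hc : ContinuousAt (fun x : E => (A + 1) * ‖x‖) 0 := by fun_prop
    exact hc.eventually_lt_const (by simpa using hr)
  refine IsBigO.of_bound (2 * C * (A + 1) ^ (k + 1)) ?_
  filter_upwards [hsmall, huA.bound, huv.def (c := 1 / 2) (by norm_num)] with x hx hux hvx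
  rcases eq_or_ne x 0 with rfl | hx0
  · have : v 0 = u 0 := by simpa [sub_eq_zero] using hvx
    simp [this]
  have hxpos : 0 < ‖x‖ := norm_pos_iff.2 hx0
  have hnorm : ∀ y ∈ ball (u x) ‖x‖, ‖y‖ ≤ (A + 1) * ‖x‖ := by
    intro y hy
    have h1 : ‖y - u x‖ < ‖x‖ := by simpa [dist_eq_norm] using hy
    have h2 : ‖y‖ ≤ ‖y - u x‖ + ‖u x‖ := by simpa using norm_add_le (y - u x) (u x)
    linarith
  have hmem : ∀ y ∈ ball (u x) ‖x‖, y ∈ ball (0 : E) r := fun y hy => by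
    simpa using (hnorm y hy).trans_lt hx
  have hbd : ∀ y ∈ ball (u x) ‖x‖, ‖ψ y‖ ≤ C * ((A + 1) * ‖x‖) ^ (k + 1) := by
    intro y hy
    have h1 := (hball y (hmem y hy)).2
    rw [norm_pow, norm_norm] at h1
    exact h1.trans (by gcongr; exact hnorm y hy)
  have hS := Complex.dist_le_div_mul_dist_of_mapsTo_ball (f := ψ) (c := u x) (z := v x)
    (R₁ := ‖x‖) (R₂ := 2 * (C * ((A + 1) * ‖x‖) ^ (k + 1)))
    (fun y hy => (hball y (hmem y hy)).1.differentiableWithinAt)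
    (fun y hy => by
      have h1 := hbd y hy
      have h2 := hbd (u x) (mem_ball_self hxpos)
      rw [mem_closedBall, dist_eq_norm]
      linarith [norm_sub_le (ψ y) (ψ (u x))])
    (by rw [mem_ball, dist_eq_norm]; linarith)
  rw [dist_eq_norm, dist_eq_norm] at hS
  refine hS.trans_eq ?_
  rw [norm_mul, norm_pow, norm_norm, norm_norm, mul_pow]
  field_simp
  ring

/-- A map that is complex differentiable near a point has continuous derivative there. -/
theorem continuousAt_fderiv_of_eventually_differentiableAt {f : E → F} {a : E}
    (hd : ∀ᶠ x in 𝓝 a, DifferentiableAt ℂ f x) : ContinuousAt (fderiv ℂ f) a := by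
  set L := fderiv ℂ f a with hL
  have ho := hd.self_of_nhds.hasFDerivAt.isLittleO
  rw [Metric.continuousAt_iff']
  intro ε hε
  obtain ⟨r, hr, hball⟩ := Metric.eventually_nhds_iff_ball.1
    (hd.and (ho.def (c := ε / 4) (by positivity)))
  filter_upwards [ball_mem_nhds a (half_pos hr)] with x hx
  rcases eq_or_ne x a with rfl | hxa
  · simpa using hε
  have hxpos : 0 < ‖x - a‖ := norm_pos_iff.2 (sub_ne_zero.2 hxa)
  rw [mem_ball, dist_eq_norm] at hx
  have hnorm : ∀ y ∈ ball x ‖x - a‖, ‖y - a‖ ≤ 2 * ‖x - a‖ := by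
    intro y hy
    have h1 : ‖y - x‖ < ‖x - a‖ := by simpa [dist_eq_norm] using hy
    have h2 : ‖y - a‖ ≤ ‖y - x‖ + ‖x - a‖ := by simpa using norm_add_le (y - x) (x - a)
    linarith
  have hmem : ∀ y ∈ ball x ‖x - a‖, y ∈ ball a r := fun y hy => by
    rw [mem_ball, dist_eq_norm]
    linarith [hnorm y hy]
  have hS := Complex.norm_fderiv_le_div_of_mapsTo_ball (f := fun y => f y - f a - L (y - a))
    (c := x) (R₁ := ‖x - a‖) (R₂ := 3 / 4 * ε * ‖x - a‖)
    (fun y hy => by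
      have := (hball y (hmem y hy)).1
      exact DifferentiableAt.differentiableWithinAt (by fun_prop))
    (fun y hy => by
      have h1 := (hball y (hmem y hy)).2
      have h2 := (hball x (hmem x (mem_ball_self hxpos))).2
      have h3 := hnorm y hy
      rw [mem_closedBall, dist_eq_norm]
      have h4 := norm_sub_le (f y - f a - L (y - a)) (f x - f a - L (x - a))
      nlinarith)
    hxpos
  have hfx := (hball x (hmem x (mem_ball_self hxpos))).1
  have hder : fderiv ℂ (fun y => f y - f a - L (y - a)) x = fderiv ℂ f x - L := by
    refine HasFDerivAt.fderiv ((hfx.hasFDerivAt.sub_const _).sub ?_)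
    exact L.hasFDerivAt.comp x ((hasFDerivAt_id x).sub_const a)
  rw [hder, mul_div_cancel_right₀ _ hxpos.ne'] at hS
  rw [dist_eq_norm]
  linarith

/-- **Holomorphic inverse function theorem** for a map tangent to the identity at `0`. -/
theorem exists_openPartialHomeomorph_of_tangent_id [CompleteSpace E] {k : E → E}
    (hd : ∀ᶠ x in 𝓝 0, DifferentiableAt ℂ k x) (h0 : k 0 = 0)
    (hk : HasFDerivAt k (ContinuousLinearMap.id ℂ E) 0) :
    ∃ e : OpenPartialHomeomorph E E, ⇑e = k ∧ 0 ∈ e.source ∧ DifferentiableOn ℂ k e.source ∧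
      DifferentiableOn ℂ e.symm e.target ∧
      HasFDerivAt e.symm (ContinuousLinearMap.id ℂ E) 0 := by
  have hc := continuousAt_fderiv_of_eventually_differentiableAt hd
  have hstrict : HasStrictFDerivAt k
      ((ContinuousLinearEquiv.refl ℂ E : E ≃L[ℂ] E) : E →L[ℂ] E) 0 := by
    have := hasStrictFDerivAt_of_hasFDerivAt_of_continuousAt
      (hd.mono fun x hx => hx.hasFDerivAt) hc
    rwa [hk.fderiv] at this
  have hinv : ∀ᶠ x in 𝓝 0, fderiv ℂ k x ∈ range ((↑) : (E ≃L[ℂ] E) → E →L[ℂ] E) := by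
    refine hc.eventually ?_
    rw [hk.fderiv]
    exact (ContinuousLinearEquiv.refl ℂ E).nhds
  obtain ⟨W, hW, hWo, h0W⟩ := _root_.eventually_nhds_iff.1 (hd.and hinv)
  refine ⟨(hstrict.toOpenPartialHomeomorph k).restrOpen W hWo, rfl,
    ⟨hstrict.mem_toOpenPartialHomeomorph_source, h0W⟩, ?_, ?_, ?_⟩
  · exact fun x hx => (hW x hx.2).1.differentiableWithinAt
  · intro z hz
    set e := (hstrict.toOpenPartialHomeomorph k).restrOpen W hWo
    obtain ⟨h1, L, hL⟩ := hW _ (e.map_target hz).2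
    have h2 := h1.hasFDerivAt
    rw [← hL] at h2
    exact (e.hasFDerivAt_symm hz h2).differentiableAt.differentiableWithinAt
  · set e := (hstrict.toOpenPartialHomeomorph k).restrOpen W hWo
    have hs : (0 : E) ∈ e.source := ⟨hstrict.mem_toOpenPartialHomeomorph_source, h0W⟩
    have he0 : e 0 = 0 := h0
    have ht : (0 : E) ∈ e.target := he0 ▸ e.map_source hs
    have hs0 : e.symm 0 = 0 := by simpa [he0] using e.left_inv hs
    refine e.hasFDerivAt_symm (f' := ContinuousLinearEquiv.refl ℂ E) ht ?_
    rw [hs0]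
    exact hk

end Holomorphic

section OneVariable

variable {F : Type*} [NormedAddCommGroup F] [NormedSpace ℂ F]

theorem eq_zero_of_pow_smul_isLittleO {q : ℂ → F} {N d : ℕ} {a : F} (hNd : N ≤ d)
    (hq : Tendsto q (𝓝 0) (𝓝 a))
    (h : (fun t : ℂ => t ^ N • q t) =o[𝓝 0] fun t => t ^ d) : a = 0 := by
  have h1 : (fun t : ℂ => t ^ d) =O[𝓝 0] fun t => t ^ N := by
    obtain ⟨j, rfl⟩ := Nat.exists_eq_add_of_le hNd
    have hc : (fun t : ℂ => t ^ j) =O[𝓝 0] fun _ => (1 : ℂ) :=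
      (Continuous.tendsto (by fun_prop) 0).isBigO_one ℂ
    simpa [pow_add] using (isBigO_refl (fun t : ℂ => t ^ N) (𝓝 0)).mul hc
  have h2 := (h.trans_isBigO h1).mono (nhdsWithin_le_nhds (s := {0}ᶜ))
  have h3 : q =o[𝓝[≠] 0] fun _ => (1 : ℝ) := by
    refine isLittleO_iff.2 fun c hc => ?_
    filter_upwards [h2.def hc, self_mem_nhdsWithin] with t ht ht0
    have hpos : 0 < ‖t ^ N‖ := norm_pos_iff.2 (pow_ne_zero _ ht0)
    rw [norm_smul, mul_comm] at ht
    simpa using le_of_mul_le_mul_right ht hpos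
  exact tendsto_nhds_unique (hq.mono_left nhdsWithin_le_nhds) ((isLittleO_one_iff ℝ).1 h3)

/-- A one-variable holomorphic germ `g = o(t)` satisfying `g (lam t) = lam g t + o(t ^ d)` is
`o(t ^ d)`, provided there is no resonance `lam ^ N = lam` with `2 ≤ N ≤ d`. -/
theorem isLittleO_pow_of_nonresonant [CompleteSpace F] {g : ℂ → F} {lam : ℂ} {d : ℕ}
    (hres : ∀ N, 2 ≤ N → N ≤ d → lam ^ N ≠ lam)
    (hd : ∀ᶠ t in 𝓝 0, DifferentiableAt ℂ g t)
    (hg : g =o[𝓝 0] fun t => t)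
    (hH : (fun t => g (lam * t) - lam • g t) =o[𝓝 0] fun t => t ^ d) :
    g =o[𝓝 0] fun t => t ^ d := by
  have han : AnalyticAt ℂ g 0 := Complex.analyticAt_iff_eventually_differentiableAt.2 hd
  by_cases htop : analyticOrderAt g 0 = ⊤
  · have hzero : g =ᶠ[𝓝 0] fun _ => 0 := analyticOrderAt_eq_top.1 htop
    exact (isLittleO_zero _ _).congr' hzero.symm .rfl
  obtain ⟨q, hq, hq0, hgq⟩ := (han.analyticOrderAt_ne_top).1 htop
  set N := analyticOrderNatAt g 0
  simp only [sub_zero] at hgq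
  have hqc : Tendsto q (𝓝 0) (𝓝 (q 0)) := hq.continuousAt
  have hN : 2 ≤ N := by
    by_contra! hlt
    refine hq0 (eq_zero_of_pow_smul_isLittleO (N := N) (d := 1) (by omega) hqc ?_)
    simpa using hg.congr' hgq .rfl
  by_cases hNd : N ≤ d
  · exfalso
    have hlt : Tendsto (fun t : ℂ => lam * t) (𝓝 0) (𝓝 0) :=
      Continuous.tendsto' (by fun_prop) _ _ (by simp)
    have hlim : Tendsto (fun t => lam ^ N • q (lam * t) - lam • q t) (𝓝 0)
        (𝓝 (lam ^ N • q 0 - lam • q 0)) :=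
      ((hqc.comp hlt).const_smul _).sub (hqc.const_smul _)
    have := eq_zero_of_pow_smul_isLittleO hNd hlim (hH.congr' (by
      filter_upwards [hgq, hlt.eventually hgq] with t h1 h2
      rw [h1, h2, mul_pow, smul_sub, smul_smul, smul_smul, smul_smul, mul_comm (lam ^ N),
        mul_comm lam (t ^ N)]) .rfl)
    rw [← sub_smul, smul_eq_zero, sub_eq_zero] at this
    exact this.elim (hres N hN hNd) hq0
  · have h1 : (fun t : ℂ => t ^ N • q t) =O[𝓝 0] fun t => t ^ N := by
      simpa using (isBigO_refl (fun t : ℂ => t ^ N) (𝓝 0)).smul (hqc.isBigO_one ℂ)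
    exact (h1.trans_isLittleO (isLittleO_pow_pow (not_le.1 hNd))).congr' hgq.symm .rfl

end OneVariable

section NormalForm

variable {E : Type*} [NormedAddCommGroup E] [NormedSpace ℂ E]

theorem eventually_differentiableAt_iterate {f : E → E}
    (hd : ∀ᶠ x in 𝓝 0, DifferentiableAt ℂ f x) (h0 : f 0 = 0) (j : ℕ) :
    ∀ᶠ x in 𝓝 0, DifferentiableAt ℂ f^[j] x := by
  induction j with
  | zero => exact .of_forall fun x => differentiableAt_id
  | succ j ih =>
    have hc : Tendsto f (𝓝 0) (𝓝 0) := by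
      simpa [ContinuousAt, h0] using hd.self_of_nhds.continuousAt
    filter_upwards [hd, hc.eventually ih] with x h1 h2
    rw [Function.iterate_succ]
    exact h2.comp x h1

theorem hasFDerivAt_iterate_smul_id {f : E → E} {lam : ℂ} (h0 : f 0 = 0)
    (hf : HasFDerivAt f (lam • ContinuousLinearMap.id ℂ E) 0) (j : ℕ) :
    HasFDerivAt f^[j] (lam ^ j • ContinuousLinearMap.id ℂ E) 0 := by
  have h := hf.iterate h0 j
  rwa [smul_pow, ← ContinuousLinearMap.one_def, one_pow] at h

/-- If `f` has linear part `lam • id` at `0`, with no resonance `lam ^ N = lam` for `2 ≤ N ≤ m`,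
then every germ tangent to the identity and commuting with `f` agrees with the identity
to order `m`. -/
theorem isLittleO_sub_id_of_commute [CompleteSpace E] {f T : E → E} {lam : ℂ} {m : ℕ}
    (hres : ∀ N, 2 ≤ N → N ≤ m → lam ^ N ≠ lam)
    (hfd : ∀ᶠ x in 𝓝 0, DifferentiableAt ℂ f x) (hf0 : f 0 = 0)
    (hf : HasFDerivAt f (lam • ContinuousLinearMap.id ℂ E) 0)
    (hTd : ∀ᶠ x in 𝓝 0, DifferentiableAt ℂ T x) (hT0 : T 0 = 0)
    (hT : HasFDerivAt T (ContinuousLinearMap.id ℂ E) 0)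
    (hcomm : Function.Commute f T) (hm : 1 ≤ m) :
    (fun x => T x - x) =o[𝓝 0] fun x => ‖x‖ ^ m := by
  set G : E → E := fun x => T x - x with hG
  set φ : E → E := fun x => f x - lam • x with hφ
  have hGd : ∀ᶠ x in 𝓝 0, DifferentiableAt ℂ G x := hTd.mono fun x hx => by fun_prop
  have hφd : ∀ᶠ x in 𝓝 0, DifferentiableAt ℂ φ x := hfd.mono fun x hx => by fun_prop
  have hG0 : G 0 = 0 := by simp [hG, hT0]
  have hφ0 : φ 0 = 0 := by simp [hφ, hf0]
  have hGo : G =o[𝓝 0] fun x => x := by simpa [hT0] using hT.isLittleO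
  have hφo : φ =o[𝓝 0] fun x => x := by simpa [hf0] using hf.isLittleO
  have hφO : φ =O[𝓝 0] fun x => ‖x‖ ^ (1 + 1) :=
    isBigO_norm_pow_succ_of_isLittleO hφd hφ0 (by simpa using hφo.norm_right)
  suffices ∀ e, 1 ≤ e → e ≤ m → G =o[𝓝 0] fun x => ‖x‖ ^ e from this m hm le_rfl
  intro e he
  induction e, he using Nat.le_induction with
  | base => exact fun _ => by simpa using hGo.norm_right
  | succ e he ih =>
    intro hem
    have hGO := isBigO_norm_pow_succ_of_isLittleO hGd hG0 (ih (by omega))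
    have hlamO : (fun x : E => lam • x) =O[𝓝 0] fun x => x :=
      (isBigO_refl _ _).const_smul_left lam
    have h1 : (fun x => G (f x) - G (lam • x)) =o[𝓝 0] fun x => ‖x‖ ^ (e + 1) := by
      refine (isBigO_comp_sub_comp (v := f) hGd hGO hlamO hφo).trans_isLittleO ?_
      simpa [pow_succ] using
        (isBigO_refl (fun x : E => ‖x‖ ^ e) (𝓝 0)).mul_isLittleO hφo.norm_norm
    have h2 : (fun x => φ (T x) - φ x) =o[𝓝 0] fun x => ‖x‖ ^ (e + 1) := by
      refine (isBigO_comp_sub_comp (v := T) (u := fun x => x) hφd hφO (isBigO_refl _ _)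
        hGo).trans_isLittleO ?_
      have h3 : (fun x : E => ‖x‖ ^ 1) =o[𝓝 0] fun _ => (1 : ℝ) := by
        rw [isLittleO_one_iff]
        exact Continuous.tendsto' (by fun_prop) _ _ (by simp)
      simpa using h3.mul_isBigO hGO.norm_left
    have hH : (fun x => G (lam • x) - lam • G x) =o[𝓝 0] fun x => ‖x‖ ^ (e + 1) := by
      refine (h2.sub h1).congr_left fun x => ?_
      simp only [hG, hφ, hcomm x, smul_sub]
      rw [← hcomm x]
      abel
    have hline : ∀ v : E, (fun t : ℂ => G (t • v)) =o[𝓝 0] fun t => t ^ (e + 1) := by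
      intro v
      have ht : Tendsto (fun t : ℂ => t • v) (𝓝 0) (𝓝 0) :=
        Continuous.tendsto' (by fun_prop) _ _ (by simp)
      refine isLittleO_pow_of_nonresonant (lam := lam)
        (fun N h2 hN => hres N h2 (by omega)) ?_ ?_ ?_
      · filter_upwards [ht.eventually hGd] with t h
        exact DifferentiableAt.comp (f := fun t : ℂ => t • v) t h (by fun_prop)
      · refine (hGo.comp_tendsto ht).trans_isBigO (IsBigO.of_bound ‖v‖ (.of_forall fun t => ?_))
        simp [norm_smul, mul_comm]
      · refine ((hH.comp_tendsto ht).congr_left fun t => ?_).trans_isBigO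
          (IsBigO.of_bound (‖v‖ ^ (e + 1)) (.of_forall fun t => ?_))
        · simp [smul_smul]
        · simp [norm_smul, mul_pow, mul_comm]
    refine (isBigO_norm_pow_succ_of_forall_line hGd hG0 hline).trans_isLittleO ?_
    exact (isLittleO_pow_pow (Nat.lt_succ_self (e + 1))).comp_tendsto
      (Continuous.tendsto' continuous_norm (0 : E) 0 norm_zero)

/-- The linearizing average `(1 / m) ∑ j < m, lam ^ (-j) f^j`. -/
noncomputable def linearizingAverage (f : E → E) (lam : ℂ) (m : ℕ) (x : E) : E :=
  (m : ℂ)⁻¹ • ∑ j ∈ Finset.range m, (lam ^ j)⁻¹ • f^[j] x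

theorem linearizingAverage_apply_map {f : E → E} {lam : ℂ} {m : ℕ} (hroot : lam ^ m = 1)
    (hlam : lam ≠ 0) (x : E) :
    linearizingAverage f lam m (f x) =
      lam • linearizingAverage f lam m x + (lam * (m : ℂ)⁻¹) • (f^[m] x - x) := by
  have h1 : ∑ j ∈ Finset.range m, (lam ^ j)⁻¹ • f^[j] (f x) =
      lam • ∑ j ∈ Finset.range m, (lam ^ (j + 1))⁻¹ • f^[j + 1] x := by
    rw [Finset.smul_sum]
    refine Finset.sum_congr rfl fun j _ => ?_
    rw [Function.iterate_succ_apply, smul_smul]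
    congr 1
    rw [pow_succ]
    field_simp
  have h2 := (Finset.sum_range_succ' (fun j => (lam ^ j)⁻¹ • f^[j] x) m).symm.trans
    (Finset.sum_range_succ (fun j => (lam ^ j)⁻¹ • f^[j] x) m)
  simp only [pow_zero, inv_one, one_smul, Function.iterate_zero, id, hroot] at h2
  rw [linearizingAverage, linearizingAverage, h1, eq_sub_of_add_eq h2]
  module

theorem hasFDerivAt_linearizingAverage {f : E → E} {lam : ℂ} {m : ℕ} (hm : 0 < m)
    (hlam : lam ≠ 0) (h0 : f 0 = 0)
    (hf : HasFDerivAt f (lam • ContinuousLinearMap.id ℂ E) 0) :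
    HasFDerivAt (linearizingAverage f lam m) (ContinuousLinearMap.id ℂ E) 0 := by
  have h := (HasFDerivAt.fun_sum fun j (_ : j ∈ Finset.range m) =>
    (hasFDerivAt_iterate_smul_id h0 hf j).const_smul (lam ^ j)⁻¹).const_smul (m : ℂ)⁻¹
  have hm' : (m : ℂ) ≠ 0 := Nat.cast_ne_zero.2 hm.ne'
  have hsum : (m : ℂ)⁻¹ • ∑ j ∈ Finset.range m, (lam ^ j)⁻¹ • lam ^ j •
      ContinuousLinearMap.id ℂ E = ContinuousLinearMap.id ℂ E := by
    have hj : ∀ j ∈ Finset.range m, (lam ^ j)⁻¹ • lam ^ j • ContinuousLinearMap.id ℂ E =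
        ContinuousLinearMap.id ℂ E := fun j _ => inv_smul_smul₀ (pow_ne_zero j hlam) _
    rw [Finset.sum_congr rfl hj, Finset.sum_const, Finset.card_range, ← Nat.cast_smul_eq_nsmul ℂ,
      inv_smul_smul₀ hm']
  rw [hsum] at h
  exact h

end NormalForm

/-- **Normal form to order `m`.** If `f` is holomorphic near `0 ∈ ℂⁿ` with `f 0 = 0` and
`f'(0) = λ·I` where `λ` is a primitive `m`-th root of unity, then there is a biholomorphic
change of coordinates `h` fixing `0` with `h'(0) = I` such that the conjugate
`g = h⁻¹ ∘ f ∘ h` satisfies `g x = λ x + o(‖x‖^m)` as `x → 0`. -/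
theorem normal_form_to_order_m (m n : ℕ) (hm : 0 < m) (hn : 0 < n) (lam : ℂ)
    (hroot : lam ^ m = 1) (hprim : ∀ j : ℕ, 0 < j → j < m → lam ^ j ≠ 1)
    (f : EuclideanSpace ℂ (Fin n) → EuclideanSpace ℂ (Fin n))
    (U₀ : Set (EuclideanSpace ℂ (Fin n))) (hU₀ : IsOpen U₀) (h0U₀ : 0 ∈ U₀)
    (hf : DifferentiableOn ℂ f U₀) (hf0 : f 0 = 0)
    (hdf : fderiv ℂ f 0 = lam • ContinuousLinearMap.id ℂ (EuclideanSpace ℂ (Fin n))) :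
    ∃ (U V : Set (EuclideanSpace ℂ (Fin n)))
      (h hinv : EuclideanSpace ℂ (Fin n) → EuclideanSpace ℂ (Fin n)),
      IsOpen U ∧ IsOpen V ∧ (0 : EuclideanSpace ℂ (Fin n)) ∈ U ∧
      (0 : EuclideanSpace ℂ (Fin n)) ∈ V ∧
      DifferentiableOn ℂ h U ∧ DifferentiableOn ℂ hinv V ∧
      Set.MapsTo h U V ∧ Set.MapsTo hinv V U ∧
      (∀ x ∈ U, hinv (h x) = x) ∧ (∀ z ∈ V, h (hinv z) = z) ∧
      h 0 = 0 ∧ fderiv ℂ h 0 = ContinuousLinearMap.id ℂ (EuclideanSpace ℂ (Fin n)) ∧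
      (fun x => hinv (f (h x)) - lam • x)
        =o[nhds (0 : EuclideanSpace ℂ (Fin n))] (fun x => ‖x‖ ^ m) := by
  have hlam : lam ≠ 0 := by
    rintro rfl
    simp [hm.ne'] at hroot
  have hres : ∀ N, 2 ≤ N → N ≤ m → lam ^ N ≠ lam := by
    intro N h2 hN h
    obtain ⟨j, rfl⟩ := Nat.exists_eq_add_of_le' (show 1 ≤ N by omega)
    refine hprim j (by omega) (by omega) (mul_right_cancel₀ hlam ?_)
    rw [← pow_succ, h, one_mul]
  have hfd : ∀ᶠ x in 𝓝 0, DifferentiableAt ℂ f x := hf.eventually_differentiableAt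
    (hU₀.mem_nhds h0U₀)
  have hf' := hfd.self_of_nhds.hasFDerivAt
  rw [hdf] at hf'
  set k := linearizingAverage f lam m with hk
  have hk0 : k 0 = 0 := by
    simp [hk, linearizingAverage, Function.iterate_fixed hf0]
  have hkd : ∀ᶠ x in 𝓝 0, DifferentiableAt ℂ k x := by
    have hall := (Finset.eventually_all (Finset.range m)).2 fun j _ =>
      eventually_differentiableAt_iterate hfd hf0 j
    filter_upwards [hall] with x hx
    exact (DifferentiableAt.fun_sum fun j hj => (hx j hj).const_smul (lam ^ j)⁻¹).const_smul
      (m : ℂ)⁻¹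
  obtain ⟨e, hek, h0s, hks, hst, hs'⟩ := exists_openPartialHomeomorph_of_tangent_id hkd hk0
    (hasFDerivAt_linearizingAverage hm hlam hf0 hf')
  have he0 : e 0 = 0 := by rw [hek, hk0]
  have h0t : 0 ∈ e.target := he0 ▸ e.map_source h0s
  have hs0 : e.symm 0 = 0 := by simpa [he0] using e.left_inv h0s
  refine ⟨e.target, e.source, e.symm, k, e.open_target, e.open_source, h0t, h0s, hst, hks,
    e.mapsTo_symm, hek ▸ e.mapsTo, fun x hx => hek ▸ e.right_inv hx,
    fun z hz => hek ▸ e.left_inv hz, hs0, hs'.fderiv, ?_⟩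
  have hT := isLittleO_sub_id_of_commute hres hfd hf0 hf'
    (eventually_differentiableAt_iterate hfd hf0 m) (Function.iterate_fixed hf0 m)
    (by simpa [hroot] using hasFDerivAt_iterate_smul_id hf0 hf' m)
    ((Function.Commute.refl f).iterate_right m) hm
  have hst0 : Tendsto e.symm (𝓝 0) (𝓝 0) := by
    simpa [ContinuousAt, hs0] using hs'.continuousAt
  have hsO : e.symm =O[𝓝 0] fun x => x := by simpa [hs0] using hs'.isBigO_sub
  refine (((hT.comp_tendsto hst0).const_smul_left (lam * (m : ℂ)⁻¹)).congr'
    (f₂ := fun x => k (f (e.symm x)) - lam • x) ?_ .rfl).trans_isBigO (hsO.norm_norm.pow m)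
  filter_upwards [e.open_target.mem_nhds h0t] with x hx
  have hkx : k (e.symm x) = x := hek ▸ e.right_inv hx
  rw [hk, linearizingAverage_apply_map hroot hlam, ← hk, hkx]
  simp
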